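/- Let P̄ be an uniplicit Markov kernel on a finite set V̄, reversible with respect to a positive probability μ̄, and let Λ be a Markov kernel from V̄ to a finite set V with μ := μ̄Λ positive. Assume: (i) ΛΛ*P̄Λ = P̄Λ; (ii) H(P̄) ≠ ∅; (iii) P(V̄)Λ = P(V), i.e. every probability on V is of the form m̄Λ for some probability m̄ on V̄; (iv) for every x̄0 ∈ H(P̄), Λ(x̄0,·) is a Dirac mass δ_{π(x̄0)} for some π(x̄0) ∈ V; (v) ΛΛ*Λ = Λ. Define P := Λ*P̄Λ. Then H(P) ≠ ∅, and more precisely π(H(P̄)) ⊆ H(P). -/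

import Mathlib

open scoped BigOperators

/-- A Markov kernel on a finite set `V`: nonnegative entries, row sums equal to 1. -/
def IsMarkov {V : Type*} [Fintype V] (P : Matrix V V ℝ) : Prop :=
  (∀ x y, 0 ≤ P x y) ∧ ∀ x, ∑ y, P x y = 1

/-- Irreducibility: all entries of `∑_{n=1}^{|V|} P^n` are positive. -/
def IsIrreducibleKernel {V : Type*} [Fintype V] [DecidableEq V] (P : Matrix V V ℝ) : Prop :=
  ∀ x y, 0 < ∑ n ∈ Finset.Icc 1 (Fintype.card V), (P ^ n) x y

/-- A probability measure on `V`, seen as a nonnegative vector of total mass 1. -/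
def IsProbVec {V : Type*} [Fintype V] (m : V → ℝ) : Prop :=
  (∀ x, 0 ≤ m x) ∧ ∑ x, m x = 1

/-- A probability measure positive on all points of `V`. -/
def IsPositiveProb {V : Type*} [Fintype V] (μ : V → ℝ) : Prop :=
  (∀ x, 0 < μ x) ∧ ∑ x, μ x = 1

/-- Reversibility of `P` with respect to `μ`. -/
def IsReversible {V : Type*} (P : Matrix V V ℝ) (μ : V → ℝ) : Prop :=
  ∀ x y, μ x * P x y = μ y * P y x

/-- `P` is uniplicit: reversible with respect to some positive probability, and all its
eigenvalues have multiplicity 1 (every eigenspace has dimension at most one). -/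
def Uniplicit {V : Type*} [Fintype V] (P : Matrix V V ℝ) : Prop :=
  (∃ μ : V → ℝ, IsPositiveProb μ ∧ IsReversible P μ) ∧
  ∀ (θ : ℝ) (f g : V → ℝ), P.mulVec f = θ • f → P.mulVec g = θ • g →
    ∃ a b : ℝ, (a ≠ 0 ∨ b ≠ 0) ∧ a • f = b • g

/-- The Markov commutator of `P`: the Markov kernels commuting with `P`. -/
def MarkovCommutator {V : Type*} [Fintype V] (P : Matrix V V ℝ) : Set (Matrix V V ℝ) :=
  {K | IsMarkov K ∧ K * P = P * K}

/-- `K(P,x)`: the set of rows at `x` of elements of the Markov commutator of `P`. -/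
def commRows {V : Type*} [Fintype V] (P : Matrix V V ℝ) (x : V) : Set (V → ℝ) :=
  {m | ∃ K ∈ MarkovCommutator P, m = fun y => K x y}

/-- `H(P) := {x : K(P,x) = P(V)}`. -/
def HSet {V : Type*} [Fintype V] (P : Matrix V V ℝ) : Set V :=
  {x | commRows P x = {m | IsProbVec m}}

/-- The hypergroup property of `P` with respect to `μ` and the point `x0`. -/
def HypergroupProperty {V : Type*} [Fintype V]
    (P : Matrix V V ℝ) (μ : V → ℝ) (x0 : V) : Prop :=
  ∃ φ : Fin (Fintype.card V) → V → ℝ,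
    (∃ k1, ∀ x, φ k1 x = 1) ∧
    (∀ k l, ∑ x, μ x * φ k x * φ l x = if k = l then 1 else 0) ∧
    (∀ k, ∃ θ : ℝ, ∀ x, ∑ y, P x y * φ k y = θ * φ k x) ∧
    (∀ k, φ k x0 ≠ 0) ∧
    ∀ x y z, 0 ≤ ∑ k, φ k x * φ k y * φ k z / φ k x0

/-- `g` is a symmetry of `P`. -/
def IsSymmetry {V : Type*} (P : Matrix V V ℝ) (g : Equiv.Perm V) : Prop :=
  ∀ x y, P (g x) (g y) = P x y


/-- A Markov kernel from a finite set `V̄` to a finite set `V`. -/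
def IsMarkovRect {Vb V : Type*} [Fintype V] (Λ : Matrix Vb V ℝ) : Prop :=
  (∀ xb y, 0 ≤ Λ xb y) ∧ ∀ xb, ∑ y, Λ xb y = 1

/-- The dual kernel `Λ*` of `Λ`, with respect to `μ̄` on `V̄` and `μ = μ̄Λ` on `V`:
`Λ*(x,x̄) = μ̄(x̄)Λ(x̄,x)/μ(x)`. -/
noncomputable def dualKernel {Vb V : Type*} (μb : Vb → ℝ) (μ : V → ℝ)
    (Λ : Matrix Vb V ℝ) : Matrix V Vb ℝ :=
  Matrix.of fun x xb => μb xb * Λ xb x / μ x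

open Matrix in
/-- Matrices commuting with `P` act by scalars on one-dimensional eigenspaces of `P`. -/
lemma exists_mulVec_eq_smul_of_simple_eigenspaces {V : Type*} [Fintype V] {P A : Matrix V V ℝ}
    (hP : ∀ (θ : ℝ) (f g : V → ℝ), P *ᵥ f = θ • f → P *ᵥ g = θ • g →
      ∃ a b : ℝ, (a ≠ 0 ∨ b ≠ 0) ∧ a • f = b • g)
    (hA : A * P = P * A) {θ : ℝ} {f : V → ℝ} (hf : P *ᵥ f = θ • f) (hf0 : f ≠ 0) :
    ∃ c : ℝ, A *ᵥ f = c • f := by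
  obtain ⟨a, b, hab, h⟩ := hP θ f (A *ᵥ f) hf (by
    rw [mulVec_mulVec, ← hA, ← mulVec_mulVec, hf, mulVec_smul])
  have hb : b ≠ 0 := by
    rintro rfl
    rw [zero_smul, smul_eq_zero] at h
    simp_all
  exact ⟨b⁻¹ * a, by rw [mul_smul, h, smul_smul, inv_mul_cancel₀ hb, one_smul]⟩

open Matrix in
/-- A kernel reversible with respect to a positive weight has a spanning family of eigenvectors. -/
lemma IsReversible.eq_zero_of_mulVec_eigenvectors {V : Type*} [Fintype V]
    {P M : Matrix V V ℝ} {μ : V → ℝ} (hμ : ∀ x, 0 < μ x) (hP : IsReversible P μ)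
    (hM : ∀ (θ : ℝ) (f : V → ℝ), P *ᵥ f = θ • f → M *ᵥ f = 0) : M = 0 := by
  classical
  have hs : ∀ x, √(μ x) ≠ 0 := fun x => (Real.sqrt_pos.2 (hμ x)).ne'
  let D : Matrix V V ℝ := diagonal fun x => √(μ x)
  let D' : Matrix V V ℝ := diagonal fun x => (√(μ x))⁻¹
  have hD : D * D' = 1 := by simp [D, D', hs]
  have hD' : D' * D = 1 := by simp [D, D', hs]
  have hS : (D * P * D').IsHermitian := by
    ext x y
    simp only [D, D', conjTranspose_apply, mul_diagonal, diagonal_mul, star_trivial]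
    have h := hP x y
    rw [← Real.mul_self_sqrt (hμ x).le, ← Real.mul_self_sqrt (hμ y).le] at h
    have := hs x
    have := hs y
    field_simp
    linear_combination -h
  have hzero : Matrix.toEuclideanLin (M * D') = 0 := by
    refine hS.eigenvectorBasis.toBasis.ext fun i => ?_
    have hv := hS.mulVec_eigenvectorBasis i
    have hP' : P *ᵥ (D' *ᵥ ⇑(hS.eigenvectorBasis i)) =
        hS.eigenvalues i • (D' *ᵥ ⇑(hS.eigenvectorBasis i)) := by
      rw [← mulVec_smul, ← hv, mulVec_mulVec, mulVec_mulVec, ← Matrix.mul_assoc,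
        ← Matrix.mul_assoc, hD', Matrix.one_mul]
    have h := hM _ _ hP'
    rw [mulVec_mulVec] at h
    simp [toLpLin_apply, h]
  have h0 : M * D' = 0 := (LinearEquiv.map_eq_zero_iff _).1 hzero
  calc M = M * D' * D := by rw [Matrix.mul_assoc, hD', Matrix.mul_one]
    _ = 0 := by rw [h0, Matrix.zero_mul]

open Matrix in
/-- The commutant of a uniplicit kernel is commutative. -/
lemma Uniplicit.mul_comm_of_commute {V : Type*} [Fintype V] {P A B : Matrix V V ℝ}
    (hP : Uniplicit P) (hA : A * P = P * A) (hB : B * P = P * B) : A * B = B * A := by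
  obtain ⟨⟨μ, hμ, hrev⟩, hsimple⟩ := hP
  refine sub_eq_zero.1 (hrev.eq_zero_of_mulVec_eigenvectors hμ.1 fun θ f hf => ?_)
  obtain rfl | hf0 := eq_or_ne f 0
  · simp
  obtain ⟨a, ha⟩ := exists_mulVec_eq_smul_of_simple_eigenspaces hsimple hA hf hf0
  obtain ⟨b, hb⟩ := exists_mulVec_eq_smul_of_simple_eigenspaces hsimple hB hf hf0
  rw [sub_mulVec, ← mulVec_mulVec, ← mulVec_mulVec, ha, hb, mulVec_smul, mulVec_smul, ha, hb,
    smul_comm, sub_self]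

lemma IsMarkovRect.mul {U V W : Type*} [Fintype V] [Fintype W] {A : Matrix U V ℝ}
    {B : Matrix V W ℝ} (hA : IsMarkovRect A) (hB : IsMarkovRect B) : IsMarkovRect (A * B) := by
  refine ⟨fun x y => Finset.sum_nonneg fun z _ => mul_nonneg (hA.1 x z) (hB.1 z y), fun x => ?_⟩
  simp only [Matrix.mul_apply]
  rw [Finset.sum_comm]
  simp [← Finset.mul_sum, hB.2, hA.2]

lemma IsMarkovRect.dualKernel {Vb V : Type*} [Fintype Vb] [Fintype V] {μb : Vb → ℝ} {μ : V → ℝ}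
    {Λ : Matrix Vb V ℝ} (hΛ : IsMarkovRect Λ) (hμb : ∀ x, 0 ≤ μb x)
    (hμ : μ = Matrix.vecMul μb Λ) (hμpos : ∀ x, 0 < μ x) :
    IsMarkovRect (dualKernel μb μ Λ) := by
  refine ⟨fun x y => div_nonneg (mul_nonneg (hμb y) (hΛ.1 y x)) (hμpos x).le, fun x => ?_⟩
  have h : ∑ y, μb y * Λ y x = μ x := by rw [hμ]; rfl
  simp only [_root_.dualKernel, Matrix.of_apply]
  rw [← Finset.sum_div, h, div_self (hμpos x).ne']

lemma isReversible_mul_dualKernel {Vb V : Type*} [Fintype V] (μb : Vb → ℝ) (μ : V → ℝ)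
    (Λ : Matrix Vb V ℝ) : IsReversible (Λ * dualKernel μb μ Λ) μb := by
  intro x y
  simp only [Matrix.mul_apply, dualKernel, Matrix.of_apply, Finset.mul_sum]
  exact Finset.sum_congr rfl fun z _ => by ring

lemma isReversible_iff_diagonal_mul {V : Type*} [Fintype V] [DecidableEq V] {P : Matrix V V ℝ}
    {μ : V → ℝ} :
    IsReversible P μ ↔ Matrix.diagonal μ * P = P.transpose * Matrix.diagonal μ := by
  simp only [IsReversible, ← Matrix.ext_iff, Matrix.diagonal_mul, Matrix.mul_diagonal,
    Matrix.transpose_apply]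
  exact forall₂_congr fun x y => by rw [mul_comm (P y x)]

/-- If the range of `E` is stable under `P`, and both are reversible, then they commute. -/
lemma IsReversible.commute_of_mul_mul_eq {V : Type*} [Fintype V] {P E : Matrix V V ℝ}
    {μ : V → ℝ} (hμ : ∀ x, 0 < μ x) (hP : IsReversible P μ) (hE : IsReversible E μ)
    (h : E * P * E = P * E) : E * P = P * E := by
  classical
  have hreg : Function.Injective fun M : Matrix V V ℝ => Matrix.diagonal μ * M := by
    intro M N hMN
    ext x y
    have := congrFun (congrFun hMN x) y
    simpa [Matrix.diagonal_mul, (hμ x).ne'] using this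
  rw [isReversible_iff_diagonal_mul] at hP hE
  refine Eq.trans (hreg ?_) h
  have ht := congrArg Matrix.transpose h
  simp only [Matrix.transpose_mul] at ht
  calc Matrix.diagonal μ * (E * P) = E.transpose * P.transpose * Matrix.diagonal μ := by
        rw [← Matrix.mul_assoc, hE, Matrix.mul_assoc, hP, Matrix.mul_assoc]
    _ = E.transpose * (P.transpose * E.transpose) * Matrix.diagonal μ := by rw [ht]
    _ = Matrix.diagonal μ * (E * P * E) := by
        simp only [Matrix.mul_assoc]
        rw [← hE, ← Matrix.mul_assoc P.transpose, ← hP, Matrix.mul_assoc,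
          ← Matrix.mul_assoc E.transpose, ← hE, Matrix.mul_assoc]

/-- Under the hypotheses (i) `ΛΛ*P̄Λ = P̄Λ`, (ii) `H(P̄) ≠ ∅`,
(iii) surjectivity of `m̄ ↦ m̄Λ` on probabilities, (iv) determinism of `Λ` on `H(P̄)`
(with values `π(x̄0)`), (v) `ΛΛ*Λ = Λ`, and uniplicity of `P̄`, the kernel `P := Λ*P̄Λ`
satisfies `H(P) ≠ ∅`, and more precisely `π(H(P̄)) ⊆ H(P)`. -/
theorem HSet_nonempty_of_intertwining
    {Vb V : Type*} [Fintype Vb] [DecidableEq Vb] [Fintype V] [DecidableEq V]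
    (Pb : Matrix Vb Vb ℝ) (hPbM : IsMarkov Pb) (hPbU : Uniplicit Pb)
    (μb : Vb → ℝ) (hμb : IsPositiveProb μb) (hrev : IsReversible Pb μb)
    (Λ : Matrix Vb V ℝ) (hΛ : IsMarkovRect Λ)
    (μ : V → ℝ) (hμdef : μ = Matrix.vecMul μb Λ) (hμpos : ∀ x, 0 < μ x)
    (Λs : Matrix V Vb ℝ) (hΛs : Λs = dualKernel μb μ Λ)
    (h_i : Λ * Λs * Pb * Λ = Pb * Λ)
    (h_ii : (HSet Pb).Nonempty)
    (h_iii : ∀ m : V → ℝ, IsProbVec m →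
      ∃ mb : Vb → ℝ, IsProbVec mb ∧ Matrix.vecMul mb Λ = m)
    (π : Vb → V)
    (h_iv : ∀ xb ∈ HSet Pb, ∀ y, Λ xb y = if y = π xb then 1 else 0)
    (h_v : Λ * Λs * Λ = Λ)
    (P : Matrix V V ℝ) (hPdef : P = Λs * Pb * Λ) :
    (HSet P).Nonempty ∧ π '' (HSet Pb) ⊆ HSet P := by
  have hΛsM : IsMarkovRect Λs := hΛs ▸ hΛ.dualKernel (fun x => (hμb.1 x).le) hμdef hμpos
  have hErev : IsReversible (Λ * Λs) μb := hΛs ▸ isReversible_mul_dualKernel μb μ Λ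
  have hE : Λ * Λs * Pb = Pb * (Λ * Λs) :=
    hrev.commute_of_mul_mul_eq hμb.1 hErev (by
      rw [← Matrix.mul_assoc, h_i, Matrix.mul_assoc])
  have hsub : π '' HSet Pb ⊆ HSet P := by
    rintro _ ⟨x, hx, rfl⟩
    refine Set.Subset.antisymm ?_ fun m hm => ?_
    · rintro _ ⟨K, hK, rfl⟩
      exact ⟨hK.1.1 _, hK.1.2 _⟩
    obtain ⟨mb, hmb, rfl⟩ := h_iii m hm
    obtain ⟨Kb, ⟨hKbM, hKbP⟩, rfl⟩ : mb ∈ commRows Pb x := by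
      rw [show commRows Pb x = _ from hx]
      exact hmb
    have hKE : Kb * (Λ * Λs) = Λ * Λs * Kb := hPbU.mul_comm_of_commute hKbP hE
    have hΛK : Λ * (Λs * Kb * Λ) = Kb * Λ := by
      calc Λ * (Λs * Kb * Λ) = Λ * Λs * Kb * Λ := by simp only [Matrix.mul_assoc]
        _ = Kb * (Λ * Λs * Λ) := by rw [← hKE, Matrix.mul_assoc]
        _ = Kb * Λ := by rw [h_v]
    refine ⟨Λs * Kb * Λ, ⟨(hΛsM.mul hKbM).mul hΛ, ?_⟩, funext fun y => ?_⟩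
    · calc Λs * Kb * Λ * P = Λs * Kb * (Λ * Λs * Pb * Λ) := by
            rw [hPdef]; simp only [Matrix.mul_assoc]
        _ = Λs * (Kb * Pb) * Λ := by rw [h_i]; simp only [Matrix.mul_assoc]
        _ = Λs * Pb * (Kb * Λ) := by rw [hKbP]; simp only [Matrix.mul_assoc]
        _ = P * (Λs * Kb * Λ) := by rw [← hΛK, hPdef]; simp only [Matrix.mul_assoc]
    · have h := congrFun (congrFun hΛK x) y
      rw [Matrix.mul_apply] at h
      simp only [h_iv x hx, ite_mul, one_mul, zero_mul, Finset.sum_ite_eq',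
        Finset.mem_univ, if_true] at h
      exact h.symm
  exact ⟨(h_ii.image π).mono hsub, hsub⟩
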